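/- Let c > 1 and A > 0 be constants such that every set S of an even number of points in the plane in general position whose convex hull is a triangle (exactly 3 convex-hull vertices) satisfies sc(S) ≤ A · c^{|S|}. Then there is a constant A' > 0 such that sc(S) ≤ A' · c^{|S|} holds for every finite set S of points in the plane in general position. -/

import Mathlib

open scoped Classical

noncomputable section

/-- Points of the plane. -/
abbrev Pt : Type := ℝ × ℝ

/-- A finite point set is in general position if no three of its points are collinear. -/
def GenPos (S : Finset Pt) : Prop :=
  ∀ p ∈ S, ∀ q ∈ S, ∀ r ∈ S, p ≠ q → p ≠ r → q ≠ r →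
    ¬ Collinear ℝ ({p, q, r} : Set Pt)

/-- The closed straight segment spanned by an unordered pair of points. -/
def seg2 (e : Sym2 Pt) : Set Pt :=
  Sym2.lift ⟨fun p q => segment ℝ p q, fun p q => segment_symm ℝ p q⟩ e

/-- A crossing-free straight-edge graph (plane graph) on the point set `S`:
its edges are straight segments between points of `S`, any two of which
meet only at shared endpoints. -/
structure PlaneGraph (S : Finset Pt) where
  edges : Finset (Sym2 Pt)
  endpoint_mem : ∀ e ∈ edges, ∀ p, p ∈ e → p ∈ S
  not_isDiag : ∀ e ∈ edges, ¬ e.IsDiag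
  noncrossing : ∀ e₁ ∈ edges, ∀ e₂ ∈ edges, e₁ ≠ e₂ →
    ∀ x ∈ seg2 e₁ ∩ seg2 e₂, x ∈ e₁ ∧ x ∈ e₂

/-- A triangulation of `S` is a maximal plane graph on `S`. -/
def IsTriangulation {S : Finset Pt} (T : PlaneGraph S) : Prop :=
  ∀ G : PlaneGraph S, T.edges ⊆ G.edges → G.edges = T.edges

/-- `tr S`: the number of triangulations of `S`. -/
def triCount (S : Finset Pt) : ℕ :=
  Nat.card {T : PlaneGraph S // IsTriangulation T}

/-- A plane graph is a spanning cycle of `S` if its edges form a Hamiltonian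
cycle on `S`. -/
def IsSpanningCycle {S : Finset Pt} (G : PlaneGraph S) : Prop :=
  3 ≤ S.card ∧ ∃ f : Fin S.card ≃ {p : Pt // p ∈ S},
    G.edges =
      Finset.image (fun i : Fin S.card => s(((f i : Pt)), ((f (finRotate S.card i) : Pt)))) Finset.univ

/-- `sc S`: the number of crossing-free straight-edge spanning cycles of `S`. -/
def scCount (S : Finset Pt) : ℕ :=
  Nat.card {G : PlaneGraph S // IsSpanningCycle G}

/-- A plane graph is a perfect matching of `S` if every point of `S` is incident
to exactly one edge. -/
def IsPerfectMatching {S : Finset Pt} (G : PlaneGraph S) : Prop :=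
  ∀ p ∈ S, ∃! e, e ∈ G.edges ∧ p ∈ e

/-- `pm S`: the number of crossing-free straight-edge perfect matchings of `S`. -/
def pmCount (S : Finset Pt) : ℕ :=
  Nat.card {G : PlaneGraph S // IsPerfectMatching G}

/-- The support of a plane graph `G` on `S`: the number of triangulations of `S`
containing all edges of `G`. -/
def supp {S : Finset Pt} (G : PlaneGraph S) : ℕ :=
  Nat.card {T : PlaneGraph S // IsTriangulation T ∧ G.edges ⊆ T.edges}

/-- A finite set of points is in (strictly) convex position. -/
def InConvexPosition (Q : Finset Pt) : Prop :=
  ∀ p ∈ Q, p ∉ convexHull ℝ (↑(Q.erase p) : Set Pt)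

/-- `p q` is an edge of the convex hull boundary of `Q`. -/
def IsHullEdgeOf (Q : Finset Pt) (p q : Pt) : Prop :=
  p ∈ Q ∧ q ∈ Q ∧ p ≠ q ∧
    segment ℝ p q ⊆ frontier (convexHull ℝ (Q : Set Pt))

/-- `e` is a diagonal of the convex polygon with vertex set `Q`. -/
def IsDiagonalOf (Q : Finset Pt) (e : Sym2 Pt) : Prop :=
  ∃ p ∈ Q, ∃ q ∈ Q, e = s(p, q) ∧
    openSegment ℝ p q ⊆ interior (convexHull ℝ (Q : Set Pt))

/-- `F` is a set of ps-flippable (pseudo-simultaneously flippable) edges of the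
triangulation `T`: the edges of `F` are diagonals of pairwise interior-disjoint
(empty) convex polygons whose boundary edges all belong to `T`. -/
def IsPsFlippable {S : Finset Pt} (T : PlaneGraph S) (F : Finset (Sym2 Pt)) : Prop :=
  F ⊆ T.edges ∧
  ∃ 𝒬 : Finset (Finset Pt),
    (∀ Q ∈ 𝒬, ↑Q ⊆ (S : Set Pt) ∧ 3 ≤ Q.card ∧ InConvexPosition Q ∧
      (∀ p q, IsHullEdgeOf Q p q → s(p, q) ∈ T.edges) ∧
      (∀ p ∈ S, p ∉ interior (convexHull ℝ (Q : Set Pt)))) ∧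
    (∀ Q ∈ 𝒬, ∀ Q' ∈ 𝒬, Q ≠ Q' →
      interior (convexHull ℝ (Q : Set Pt)) ∩ interior (convexHull ℝ (Q' : Set Pt)) = ∅) ∧
    (∀ e ∈ F, ∃ Q ∈ 𝒬, IsDiagonalOf Q e)

/-- The drawing of a plane graph: the union of its (closed) edge segments and
its vertex set. -/
def drawing {S : Finset Pt} (G : PlaneGraph S) : Set Pt :=
  (⋃ e ∈ G.edges, seg2 e) ∪ (S : Set Pt)

/-- A convex decomposition of `S`: a plane graph containing all convex hull
boundary edges, whose bounded faces are all convex, and with no isolated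
vertices. -/
def IsConvexDecomposition {S : Finset Pt} (D : PlaneGraph S) : Prop :=
  (∀ p q, IsHullEdgeOf S p q → s(p, q) ∈ D.edges) ∧
  (∀ x ∉ drawing D, Bornology.IsBounded (connectedComponentIn (drawing D)ᶜ x) →
    Convex ℝ (connectedComponentIn (drawing D)ᶜ x)) ∧
  (∀ p ∈ S, ∃ e ∈ D.edges, p ∈ e)

/-- `p` is an interior vertex of `S` (not on the convex hull boundary). -/
def InteriorVtx (S : Finset Pt) (p : Pt) : Prop :=
  p ∈ S ∧ p ∉ frontier (convexHull ℝ (S : Set Pt))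

/-- `p` has a valid triple of edges in `G`. -/
def IsValidAt {S : Finset Pt} (G : PlaneGraph S) (p : Pt) : Prop :=
  ∃ a ∈ S, ∃ b ∈ S, ∃ c ∈ S,
    p ∈ convexHull ℝ ({a, b, c} : Set Pt) ∧
    s(p, a) ∈ G.edges ∧ s(p, b) ∈ G.edges ∧ s(p, c) ∈ G.edges

/-- The degree of a point in a plane graph. -/
def degree {S : Finset Pt} (G : PlaneGraph S) (p : Pt) : ℕ :=
  (G.edges.filter (fun e => p ∈ e)).card

/-- `a b c` span a triangular face of the triangulation `T`. -/
def IsTriFace {S : Finset Pt} (T : PlaneGraph S) (a b c : Pt) : Prop :=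
  a ∈ S ∧ b ∈ S ∧ c ∈ S ∧
  s(a, b) ∈ T.edges ∧ s(b, c) ∈ T.edges ∧ s(a, c) ∈ T.edges ∧
  ∀ p ∈ S, p ∉ interior (convexHull ℝ ({a, b, c} : Set Pt))

/-- An edge of a triangulation is flippable if its two incident triangles form
a convex quadrilateral. -/
def IsFlippable {S : Finset Pt} (T : PlaneGraph S) (e : Sym2 Pt) : Prop :=
  e ∈ T.edges ∧ ∃ a b c d : Pt, e = s(a, b) ∧ c ≠ d ∧
    IsTriFace T a b c ∧ IsTriFace T a b d ∧
    (openSegment ℝ a b ∩ openSegment ℝ c d).Nonempty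

/-- `flip T`: the number of flippable edges of `T`. -/
def flipCount {S : Finset Pt} (T : PlaneGraph S) : ℕ :=
  (T.edges.filter (fun e => IsFlippable T e)).card

/-- `v3 T`: the number of interior vertices of degree 3 in `T`. -/
def v3 {S : Finset Pt} (T : PlaneGraph S) : ℕ :=
  (S.filter (fun p => p ∉ frontier (convexHull ℝ (S : Set Pt)) ∧ degree T p = 3)).card

/-- The number of vertices of `S` on its convex hull boundary. -/
def hullVtxCount (S : Finset Pt) : ℕ :=
  (S.filter (fun p => p ∈ frontier (convexHull ℝ (S : Set Pt)))).card

/-! ### Combinatorics of cycles -/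

def CycE (S : Finset Pt) (E : Finset (Sym2 Pt)) : Prop :=
  3 ≤ S.card ∧ ∃ f : Fin S.card ≃ {p : Pt // p ∈ S},
    E = Finset.image (fun i : Fin S.card => s(((f i : Pt)), ((f (finRotate S.card i) : Pt)))) Finset.univ

lemma cycE_iff (S : Finset Pt) (E : Finset (Sym2 Pt)) :
    CycE S E ↔ ∃ m : ℕ, 2 ≤ m ∧ ∃ g : Fin (m+1) → Pt, Function.Injective g ∧
      Finset.image g Finset.univ = S ∧
      E = Finset.image (fun i => s(g i, g (i+1))) Finset.univ := by
  constructor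
  · rintro ⟨h3, f, hE⟩
    have key : ∀ n : ℕ, 3 ≤ n → ∀ f : Fin n ≃ {p : Pt // p ∈ S},
      E = Finset.image (fun i : Fin n => s(((f i : Pt)), ((f (finRotate n i) : Pt)))) Finset.univ →
      ∃ m : ℕ, 2 ≤ m ∧ ∃ g : Fin (m+1) → Pt, Function.Injective g ∧
      Finset.image g Finset.univ = S ∧
      E = Finset.image (fun i => s(g i, g (i+1))) Finset.univ := by
      intro n hn f hE
      obtain ⟨m, rfl⟩ : ∃ m, n = m + 1 := ⟨n - 1, by omega⟩
      refine ⟨m, by omega, fun i => (f i : Pt), ?_, ?_, ?_⟩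
      · intro i j hij
        exact f.injective (Subtype.ext hij)
      · ext x
        simp only [Finset.mem_image, Finset.mem_univ, true_and]
        constructor
        · rintro ⟨i, rfl⟩
          exact (f i).2
        · intro hx
          exact ⟨f.symm ⟨x, hx⟩, by simp⟩
      · rw [hE]
        simp only [finRotate_apply]
    exact key _ h3 f hE
  · rintro ⟨m, hm, g, hg, hS, hE⟩
    have hcard : S.card = m + 1 := by
      rw [← hS, Finset.card_image_of_injective _ hg]; simp
    refine ⟨by omega, ?_⟩
    rw [hcard]
    refine ⟨Equiv.ofBijective (fun i => ⟨g i, by rw [← hS]; simp⟩) ⟨?_, ?_⟩, ?_⟩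
    · intro i j hij
      exact hg (by simpa using hij)
    · rintro ⟨x, hx⟩
      rw [← hS] at hx
      simp only [Finset.mem_image, Finset.mem_univ, true_and] at hx
      obtain ⟨i, rfl⟩ := hx
      exact ⟨i, rfl⟩
    · rw [hE]
      simp only [finRotate_apply]
      rfl

lemma cyc_rotate {m : ℕ} (g : Fin (m+1) → Pt) (k : Fin (m+1)) :
    Finset.image (fun i => s(g i, g (i+1))) Finset.univ =
    Finset.image (fun i => s(g (i+k), g (i+1+k))) Finset.univ := by
  ext e
  simp only [Finset.mem_image, Finset.mem_univ, true_and]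
  constructor
  · rintro ⟨i, rfl⟩
    refine ⟨i - k, ?_⟩
    rw [sub_add_cancel, show i - k + 1 + k = i + 1 by abel]
  · rintro ⟨i, rfl⟩
    refine ⟨i + k, ?_⟩
    rw [show i + k + 1 = i + 1 + k by abel]

lemma fin_add_one_ne {m : ℕ} (hm : 2 ≤ m) (i : Fin (m+1)) : i + 1 ≠ i := by
  intro h
  have : (1 : Fin (m+1)) = 0 := by simpa using h
  rw [Fin.ext_iff] at this
  simp at this
  omega

lemma fin_add_two_ne {m : ℕ} (hm : 2 ≤ m) (i : Fin (m+1)) : i + 1 + 1 ≠ i := by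
  intro h
  have : (1 + 1 : Fin (m+1)) = 0 := by
    rw [add_assoc] at h
    simpa using h
  rw [Fin.ext_iff, Fin.val_add, Fin.val_one', Fin.val_zero, Nat.mod_eq_of_lt (by omega : 1 < m + 1),
    Nat.mod_eq_of_lt (by omega)] at this
  omega

lemma cycE_insert_aux {S : Finset Pt} {x : Pt} (hx : x ∉ S) {m : ℕ} (hm : 2 ≤ m)
    (h : Fin (m+1) → Pt) (hinj : Function.Injective h) (hS : Finset.image h Finset.univ = S) :
    CycE (insert x S) (insert s(h (Fin.last m), x) (insert s(x, h 0)
      ((Finset.image (fun i => s(h i, h (i+1))) Finset.univ).erase s(h (Fin.last m), h 0)))) := by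
  rw [cycE_iff]
  have hxh : ∀ i, h i ≠ x := by
    intro i hi
    apply hx
    rw [← hS, ← hi]
    simp
  refine ⟨m + 1, by omega, Fin.cons x h, ?_, ?_, ?_⟩
  · rw [Fin.cons_injective_iff]
    exact ⟨by rintro ⟨i, hi⟩; exact hxh i hi, hinj⟩
  · ext y
    simp only [Finset.mem_image, Finset.mem_univ, true_and, Finset.mem_insert, Fin.exists_fin_succ,
      Fin.cons_zero, Fin.cons_succ, ← hS]
    tauto
  · have e0 : ((0 : Fin (m+2)) + 1) = Fin.succ 0 := by simp
    have elast : Fin.succ (Fin.last m) + 1 = 0 := by simp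
    have ej : ∀ j : Fin (m+1), j ≠ Fin.last m → Fin.succ j + 1 = Fin.succ (j + 1) := by
      intro j hj
      rw [Fin.ext_iff]
      have hj' : j < Fin.last m := Fin.lt_last_iff_ne_last.2 hj
      rw [Fin.val_succ, Fin.val_add_one_of_lt hj', Fin.val_add_one_of_lt, Fin.val_succ]
      rw [← Fin.succ_last]
      exact Fin.succ_lt_succ_iff.2 hj'
    ext e
    simp only [Finset.mem_image, Finset.mem_univ, true_and, Finset.mem_insert, Finset.mem_erase,
      Fin.exists_fin_succ (n := m+1), Fin.cons_zero, Fin.cons_succ, e0]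
    constructor
    · rintro (rfl | rfl | ⟨hne, i, rfl⟩)
      · exact Or.inr ⟨Fin.last m, by rw [elast]; simp⟩
      · exact Or.inl rfl
      · have hi : i ≠ Fin.last m := by
          rintro rfl
          apply hne
          simp
        exact Or.inr ⟨i, by rw [ej i hi]; simp⟩
    · rintro (rfl | ⟨i, rfl⟩)
      · exact Or.inr (Or.inl rfl)
      · by_cases hi : i = Fin.last m
        · subst hi
          left
          rw [elast]; simp
        · right; right
          rw [ej i hi]
          refine ⟨?_, i, by simp⟩
          simp only [Fin.cons_succ]
          intro heq
          rw [Sym2.eq_iff] at heq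
          rcases heq with ⟨h1, _⟩ | ⟨h1, h2⟩
          · exact hi (hinj h1)
          · have h1' := hinj h1
            have h2' := hinj h2
            subst h1'
            apply fin_add_two_ne hm (0 : Fin (m+1))
            rw [h2']
            simp

lemma cycE_insert {S : Finset Pt} {E : Finset (Sym2 Pt)} {x u v : Pt} (hx : x ∉ S)
    (hE : CycE S E) (huv : s(u, v) ∈ E) :
    CycE (insert x S) (insert s(u, x) (insert s(x, v) (E.erase s(u, v)))) := by
  rw [cycE_iff] at hE
  obtain ⟨m, hm, g, hg, hS, rfl⟩ := hE
  have huv' := huv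
  simp only [Finset.mem_image, Finset.mem_univ, true_and] at huv'
  obtain ⟨i, hi⟩ := huv'
  have key := cycE_insert_aux hx hm (fun j => g (j + (i + 1)))
    (fun a b hab => by simpa using hg hab) (by
      rw [← hS]
      ext y
      simp only [Finset.mem_image, Finset.mem_univ, true_and]
      constructor
      · rintro ⟨a, rfl⟩; exact ⟨_, rfl⟩
      · rintro ⟨a, rfl⟩; exact ⟨a - (i+1), by simp⟩)
  have e1 : Fin.last m + (i + 1) = i := by
    rw [add_comm i 1, ← add_assoc]; simp
  have e2 : (0 : Fin (m+1)) + (i + 1) = i + 1 := by simp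
  rw [← cyc_rotate g (i+1)] at key
  simp only [e1, e2] at key
  rw [hi] at key
  rw [Sym2.eq_iff] at hi
  rcases hi with ⟨h1, h2⟩ | ⟨h1, h2⟩
  · rw [h1, h2] at key; exact key
  · rw [h1, h2] at key
    rw [Finset.insert_comm, Sym2.eq_swap (a := u) (b := x), Sym2.eq_swap (a := x) (b := v)]
    exact key

lemma cycE_neighbors {S : Finset Pt} {E : Finset (Sym2 Pt)} {p : Pt} (hp : p ∈ S)
    (hE : CycE S E) : ∃ q ∈ S, ∃ r ∈ S, q ≠ r ∧ q ≠ p ∧ r ≠ p ∧ s(p, q) ∈ E ∧ s(p, r) ∈ E ∧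
      ∀ e ∈ E, p ∈ e → e = s(p, q) ∨ e = s(p, r) := by
  rw [cycE_iff] at hE
  obtain ⟨m, hm, g, hg, hS, rfl⟩ := hE
  have hp' := hp
  rw [← hS] at hp'
  simp only [Finset.mem_image, Finset.mem_univ, true_and] at hp'
  obtain ⟨i, rfl⟩ := hp'
  have hmem : ∀ j, g j ∈ S := fun j => by rw [← hS]; simp
  refine ⟨g (i+1), hmem _, g (i-1), hmem _, ?_, ?_, ?_, ?_, ?_, ?_⟩
  · intro h
    have := hg h
    apply fin_add_two_ne hm (i-1)
    rw [sub_add_cancel]; exact this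
  · intro h
    exact fin_add_one_ne hm i (hg h)
  · intro h
    apply fin_add_one_ne hm (i-1)
    rw [sub_add_cancel]; exact (hg h).symm
  · simp only [Finset.mem_image, Finset.mem_univ, true_and]
    exact ⟨i, rfl⟩
  · simp only [Finset.mem_image, Finset.mem_univ, true_and]
    exact ⟨i - 1, by rw [sub_add_cancel]; exact Sym2.eq_swap⟩
  · intro e he hpe
    simp only [Finset.mem_image, Finset.mem_univ, true_and] at he
    obtain ⟨j, rfl⟩ := he
    rw [Sym2.mem_iff] at hpe
    rcases hpe with h | h
    · left; rw [hg h]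
    · right
      have := hg h
      have hj : j = i - 1 := by rw [this]; simp
      rw [← h, hj]
      exact Sym2.eq_swap

/-! ### Geometry basics -/

lemma seg2_mk (a b : Pt) : seg2 s(a, b) = segment ℝ a b := rfl

def cr (p q r : Pt) : ℝ := (q.1 - p.1) * (r.2 - p.2) - (q.2 - p.2) * (r.1 - p.1)

lemma cr_ne {p q r : Pt} (h : ¬ Collinear ℝ ({p, q, r} : Set Pt)) : cr p q r ≠ 0 := by
  intro h0
  apply h
  by_cases hpq : q = p
  · subst hpq
    simpa using collinear_pair ℝ q r
  rw [collinear_iff_of_mem (p₀ := p) (by simp)]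
  refine ⟨q - p, ?_⟩
  unfold cr at h0
  intro z hz
  simp only [Set.mem_insert_iff, Set.mem_singleton_iff] at hz
  rcases hz with rfl | rfl | rfl
  · exact ⟨0, by simp⟩
  · exact ⟨1, by simp⟩
  · by_cases h1 : q.1 - p.1 = 0
    · have h2 : q.2 - p.2 ≠ 0 := by
        intro h2
        exact hpq (Prod.ext (by linarith) (by linarith))
      refine ⟨(z.2 - p.2) / (q.2 - p.2), ?_⟩
      ext
      · simp
        field_simp
        linarith
      · simp
        field_simp
        ring
    · refine ⟨(z.1 - p.1) / (q.1 - p.1), ?_⟩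
      ext
      · simp
        field_simp
        ring
      · simp
        field_simp
        linarith

lemma seg_inter {x u v y : Pt} (h : ¬ Collinear ℝ ({x, u, v} : Set Pt))
    (h1 : y ∈ segment ℝ x u) (h2 : y ∈ segment ℝ x v) : y = x := by
  have h0 := cr_ne h
  obtain ⟨a, b, ha, hb, hab, rfl⟩ := h1
  obtain ⟨c, d, hc, hd, hcd, heq⟩ := h2
  have e1 := congrArg Prod.fst heq
  have e2 := congrArg Prod.snd heq
  simp only [Prod.fst_add, Prod.snd_add, Prod.smul_fst, Prod.smul_snd, smul_eq_mul] at e1 e2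
  have hb0 : b = 0 := by
    have : b * cr x u v = 0 := by
      unfold cr
      obtain rfl : a = 1 - b := by linarith
      obtain rfl : c = 1 - d := by linarith
      linear_combination (-(v.2 - x.2)) * e1 + (v.1 - x.1) * e2
    exact (mul_eq_zero.1 this).resolve_right h0
  subst hb0
  obtain rfl : a = 1 := by linarith
  simp

def IsAff (F : Pt → ℝ) : Prop := ∀ (a b : Pt) (s t : ℝ), s + t = 1 →
  F (s • a + t • b) = s * F a + t * F b

lemma IsAff.pos {F : Pt → ℝ} (hF : IsAff F) {a b y : Pt} (hy : y ∈ segment ℝ a b)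
    (ha : 0 < F a) (hb : 0 < F b) : 0 < F y := by
  obtain ⟨s, t, hs, ht, hst, rfl⟩ := hy
  rw [hF _ _ _ _ hst]
  rcases hs.eq_or_lt with h | h
  · have : t = 1 := by linarith
    subst h; subst this; simpa using hb
  · have := mul_pos h ha
    have := mul_nonneg ht hb.le
    linarith

lemma IsAff.nonneg {F : Pt → ℝ} (hF : IsAff F) {a b y : Pt} (hy : y ∈ segment ℝ a b)
    (ha : 0 ≤ F a) (hb : 0 ≤ F b) : 0 ≤ F y := by
  obtain ⟨s, t, hs, ht, hst, rfl⟩ := hy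
  rw [hF _ _ _ _ hst]
  positivity

lemma IsAff.zero {F : Pt → ℝ} (hF : IsAff F) {a b y : Pt} (hy : y ∈ segment ℝ a b)
    (ha : F a = 0) (hb : F b = 0) : F y = 0 := by
  obtain ⟨s, t, hs, ht, hst, rfl⟩ := hy
  rw [hF _ _ _ _ hst, ha, hb]; simp

lemma IsAff.eq_end {F : Pt → ℝ} (hF : IsAff F) {a b y : Pt} (hy : y ∈ segment ℝ a b)
    (ha : F a = 0) (hb : 0 < F b) (h : F y ≤ 0) : y = a := by
  obtain ⟨s, t, hs, ht, hst, rfl⟩ := hy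
  rw [hF _ _ _ _ hst, ha] at h
  have ht0 : t = 0 := by
    by_contra hne
    have : 0 < t := lt_of_le_of_ne ht (Ne.symm hne)
    have := mul_pos this hb
    linarith
  subst ht0
  obtain rfl : s = 1 := by linarith
  simp

lemma IsAff.neg {F : Pt → ℝ} (hF : IsAff F) : IsAff (fun y => - F y) := by
  intro a b s t hst
  simp only [hF _ _ _ _ hst]; ring

/-- A supporting-line condition makes the segment `u x` cross no edge. -/
lemma support_noncross {S : Finset Pt} {F : Pt → ℝ} (hF : IsAff F) {u x : Pt} (hu : F u = 0)
    (hx : F x = 0) (hpos : ∀ q ∈ S, q ≠ u → 0 < F q) (G : PlaneGraph S) {e : Sym2 Pt}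
    (he : e ∈ G.edges) {y : Pt} (hy : y ∈ segment ℝ u x) (hye : y ∈ seg2 e) : y = u ∧ u ∈ e := by
  have hy0 := hF.zero hy hu hx
  have hmem := G.endpoint_mem e he
  have hd := G.not_isDiag e he
  induction e with | h a b =>
  rw [seg2_mk] at hye
  have ha := hmem a (by simp)
  have hb := hmem b (by simp)
  by_cases hau : a = u
  · subst hau
    have hba : b ≠ a := by rintro rfl; exact hd (by simp)
    exact ⟨hF.eq_end hye hu (hpos b hb hba) hy0.le, by simp⟩
  · by_cases hbu : b = u
    · subst hbu
      rw [segment_symm] at hye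
      exact ⟨hF.eq_end hye hu (hpos a ha hau) hy0.le, by simp⟩
    · have := hF.pos hye (hpos a ha hau) (hpos b hb hbu)
      linarith

/-! ### Insertion step -/

lemma planeGraph_ext {S : Finset Pt} {G H : PlaneGraph S} (h : G.edges = H.edges) : G = H := by
  cases G; cases H; simp at h; subst h; rfl

instance planeGraph_finite (S : Finset Pt) : Finite (PlaneGraph S) := by
  apply Finite.of_injective
    (fun G : PlaneGraph S => (⟨G.edges, by
      rw [Finset.mem_powerset]
      intro e he
      rw [Finset.mem_sym2_iff]
      exact G.endpoint_mem e he⟩ : {E // E ∈ S.sym2.powerset}))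
  intro G H h
  exact planeGraph_ext (by simpa using h)

def NoCross {S : Finset Pt} (G : PlaneGraph S) (u v x : Pt) : Prop :=
  ∀ e ∈ G.edges, e ≠ s(u, v) → ∀ y, y ∈ seg2 e →
    (y ∈ segment ℝ u x → y = u ∧ u ∈ e) ∧ (y ∈ segment ℝ v x → y = v ∧ v ∈ e)

lemma insert_plane {S : Finset Pt} (G : PlaneGraph S) {u v x : Pt} (hx : x ∉ S)
    (hS : GenPos (insert x S)) (huv : s(u, v) ∈ G.edges) (hn : NoCross G u v x) :
    ∃ G' : PlaneGraph (insert x S),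
      G'.edges = insert s(u, x) (insert s(x, v) (G.edges.erase s(u, v))) := by
  have hu : u ∈ S := G.endpoint_mem _ huv u (by simp)
  have hv : v ∈ S := G.endpoint_mem _ huv v (by simp)
  have huv' : u ≠ v := by
    have := G.not_isDiag _ huv
    simpa using this
  have hxu : x ≠ u := by rintro rfl; exact hx hu
  have hxv : x ≠ v := by rintro rfl; exact hx hv
  have hcol : ¬ Collinear ℝ ({x, u, v} : Set Pt) :=
    hS x (by simp) u (by simp [hu]) v (by simp [hv]) hxu hxv huv'
  have A : ∀ y ∈ segment ℝ u x, y ∈ segment ℝ x v → y = x := by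
    intro y h1 h2
    rw [segment_symm] at h1
    exact seg_inter hcol h1 h2
  refine ⟨⟨insert s(u, x) (insert s(x, v) (G.edges.erase s(u, v))), ?_, ?_, ?_⟩, rfl⟩
  · intro e he p hp
    simp only [Finset.mem_insert, Finset.mem_erase] at he ⊢
    rcases he with rfl | rfl | ⟨_, he⟩
    · rw [Sym2.mem_iff] at hp
      rcases hp with rfl | rfl <;> simp [*]
    · rw [Sym2.mem_iff] at hp
      rcases hp with rfl | rfl <;> simp [*]
    · exact Or.inr (G.endpoint_mem e he p hp)
  · intro e he
    simp only [Finset.mem_insert, Finset.mem_erase] at he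
    rcases he with rfl | rfl | ⟨_, he⟩
    · simpa using hxu.symm
    · simpa using hxv
    · exact G.not_isDiag e he
  · intro e₁ he₁ e₂ he₂ hne y hy
    obtain ⟨hy1, hy2⟩ := hy
    simp only [Finset.mem_insert, Finset.mem_erase] at he₁ he₂
    rcases he₁ with rfl | rfl | ⟨hne1, he₁⟩ <;> rcases he₂ with rfl | rfl | ⟨hne2, he₂⟩
    · exact absurd rfl hne
    · have := A y hy1 hy2
      subst this; simp
    · have := (hn _ he₂ hne2 y hy2).1 hy1
      obtain ⟨rfl, h⟩ := this
      exact ⟨by simp, h⟩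
    · have := A y hy2 hy1
      subst this; simp
    · exact absurd rfl hne
    · rw [seg2_mk, segment_symm] at hy1
      have := (hn _ he₂ hne2 y hy2).2 hy1
      obtain ⟨rfl, h⟩ := this
      exact ⟨by simp, h⟩
    · have := (hn _ he₁ hne1 y hy1).1 hy2
      obtain ⟨rfl, h⟩ := this
      exact ⟨h, by simp⟩
    · rw [seg2_mk, segment_symm] at hy2
      have := (hn _ he₁ hne1 y hy1).2 hy2
      obtain ⟨rfl, h⟩ := this
      exact ⟨h, by simp⟩
    · exact G.noncrossing _ he₁ _ he₂ hne y ⟨hy1, hy2⟩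

def contr (x u : Pt) : Pt → Pt := fun z => if z = x then u else z

lemma contract_insert {S : Finset Pt} (G : PlaneGraph S) {u v x : Pt} (hx : x ∉ S)
    (huv : s(u, v) ∈ G.edges) :
    ((insert s(u, x) (insert s(x, v) (G.edges.erase s(u, v)))).erase s(u, x)).image
      (Sym2.map (contr x u)) = G.edges := by
  have hu : u ∈ S := G.endpoint_mem _ huv u (by simp)
  have hv : v ∈ S := G.endpoint_mem _ huv v (by simp)
  have hxu : x ≠ u := by rintro rfl; exact hx hu
  have hxv : v ≠ x := by rintro rfl; exact hx hv
  have huv' : u ≠ v := by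
    have := G.not_isDiag _ huv
    simpa using this
  have hfix : ∀ e ∈ G.edges, Sym2.map (contr x u) e = e := by
    intro e he
    have hmem := G.endpoint_mem e he
    induction e with | h a b =>
    have ha : a ≠ x := by rintro rfl; exact hx (hmem _ (by simp))
    have hb : b ≠ x := by rintro rfl; exact hx (hmem _ (by simp))
    simp [contr, ha, hb]
  have hxe : ∀ e ∈ G.edges, x ∉ e := fun e he h => hx (G.endpoint_mem e he x h)
  have hmap : Sym2.map (contr x u) s(x, v) = s(u, v) := by
    simp [contr, hxv]
  ext e
  simp only [Finset.mem_image, Finset.mem_erase, Finset.mem_insert]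
  constructor
  · rintro ⟨e', ⟨hne, rfl | rfl | ⟨h1, h2⟩⟩, rfl⟩
    · exact absurd rfl hne
    · rw [hmap]; exact huv
    · rw [hfix _ h2]; exact h2
  · intro he
    by_cases h : e = s(u, v)
    · refine ⟨s(x, v), ⟨?_, Or.inr (Or.inl rfl)⟩, by rw [hmap, h]⟩
      intro heq
      rw [Sym2.eq_iff] at heq
      rcases heq with ⟨h1, _⟩ | ⟨_, h2⟩
      · exact hxu h1
      · exact huv' h2.symm
    · refine ⟨e, ⟨?_, Or.inr (Or.inr ⟨h, he⟩)⟩, hfix e he⟩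
      rintro rfl
      exact hxe _ he (by simp)

lemma step {S : Finset Pt} {u x : Pt} (hx : x ∉ S) (hS : GenPos (insert x S))
    (P : PlaneGraph S → Prop)
    (hP : ∀ G : PlaneGraph S, IsSpanningCycle G → P G →
      ∃ v, s(u, v) ∈ G.edges ∧ NoCross G u v x) :
    Nat.card {G : PlaneGraph S // IsSpanningCycle G ∧ P G} ≤
    Nat.card {G : PlaneGraph (insert x S) // IsSpanningCycle G ∧ s(u, x) ∈ G.edges} := by
  have key : ∀ G : {G : PlaneGraph S // IsSpanningCycle G ∧ P G},
      ∃ G' : {G : PlaneGraph (insert x S) // IsSpanningCycle G ∧ s(u, x) ∈ G.edges},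
      (G'.1.edges.erase s(u, x)).image (Sym2.map (contr x u)) = G.1.edges := by
    rintro ⟨G, hG, hPG⟩
    obtain ⟨v, huv, hn⟩ := hP G hG hPG
    obtain ⟨G', hG'⟩ := insert_plane G hx hS huv hn
    refine ⟨⟨G', ?_, ?_⟩, ?_⟩
    · have : CycE (insert x S) G'.edges := by
        rw [hG']
        exact cycE_insert hx hG huv
      exact this
    · rw [hG']; simp
    · simp only
      rw [hG']
      exact contract_insert G hx huv
  choose φ hφ using key
  apply Nat.card_le_card_of_injective φ
  intro G H h
  apply Subtype.ext
  apply planeGraph_ext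
  rw [← hφ G, ← hφ H, h]

/-! ### Genericity -/

lemma exists_generic {S : Finset Pt} (hS : GenPos S) {U : Set Pt} (hU : IsOpen U)
    (hne : U.Nonempty) : ∃ x ∈ U, x ∉ S ∧ GenPos (insert x S) := by
  have hnull : MeasureTheory.volume
      ((S : Set Pt) ∪ ⋃ a ∈ S, ⋃ b ∈ S.erase a, ((line[ℝ, a, b] : AffineSubspace ℝ Pt) : Set Pt)) = 0 := by
    rw [MeasureTheory.measure_union_null_iff]
    refine ⟨S.finite_toSet.measure_zero _, ?_⟩
    refine (MeasureTheory.measure_biUnion_null_iff S.countable_toSet).2 ?_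
    intro a ha
    refine (MeasureTheory.measure_biUnion_null_iff (S.erase a).countable_toSet).2 ?_
    intro b hb
    apply MeasureTheory.Measure.addHaar_affineSubspace
    intro htop
    have hab : b ≠ a := (Finset.mem_erase.1 hb).1
    have hm : ((a.1 - (b.2 - a.2), a.2 + (b.1 - a.1)) : Pt) ∈ line[ℝ, a, b] := by
      rw [htop]; trivial
    rw [mem_affineSpan_pair_iff_exists_lineMap_eq] at hm
    obtain ⟨r, hr⟩ := hm
    have e1 := congrArg Prod.fst hr
    have e2 := congrArg Prod.snd hr
    simp [AffineMap.lineMap_apply] at e1 e2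
    have h3 : (b.1 - a.1) ^ 2 + (b.2 - a.2) ^ 2 = 0 := by
      linear_combination (b.2 - a.2) * e1 - (b.1 - a.1) * e2
    have h4 : b.1 - a.1 = 0 := by nlinarith [sq_nonneg (b.1 - a.1), sq_nonneg (b.2 - a.2)]
    have h5 : b.2 - a.2 = 0 := by nlinarith [sq_nonneg (b.1 - a.1), sq_nonneg (b.2 - a.2)]
    exact hab (Prod.ext (by linarith) (by linarith))
  have hpos : 0 < MeasureTheory.volume U := hU.measure_pos _ hne
  obtain ⟨x, hxU, hx⟩ : ∃ x ∈ U, x ∉ ((S : Set Pt) ∪ ⋃ a ∈ S, ⋃ b ∈ S.erase a,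
      ((line[ℝ, a, b] : AffineSubspace ℝ Pt) : Set Pt)) := by
    by_contra! hcon
    have := MeasureTheory.measure_mono_null hcon hnull
    exact hpos.ne' this
  simp only [Set.mem_union, Finset.mem_coe, Set.mem_iUnion, not_or, not_exists] at hx
  obtain ⟨hxS, hx⟩ := hx
  have hline : ∀ a ∈ S, ∀ b ∈ S, a ≠ b → ¬ Collinear ℝ ({x, a, b} : Set Pt) := by
    intro a ha b hb hab hcol
    apply hx a ha b (Finset.mem_erase.2 ⟨hab.symm, hb⟩)
    exact hcol.mem_affineSpan_of_mem_of_ne (by simp) (by simp) (by simp) hab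
  refine ⟨x, hxU, hxS, ?_⟩
  intro p hp q hq r hr hpq hpr hqr
  rw [Finset.mem_insert] at hp hq hr
  rcases hp with rfl | hp
  · exact hline q (hq.resolve_left hpq.symm) r (hr.resolve_left hpr.symm) hqr
  · rcases hq with rfl | hq
    · rw [Set.insert_comm]
      exact hline p hp r (hr.resolve_left hqr.symm) hpr
    · rcases hr with rfl | hr
      · have : ({p, q, r} : Set Pt) = {r, p, q} := by
          ext; simp; tauto
        rw [this]
        exact hline p hp q hq hpq
      · exact hS p hp q hq r hr hpq hpr hqr

lemma close_seg {K : Set Pt} (hK : IsClosed K) (p q : Pt) (h : Disjoint (segment ℝ p q) K) :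
    ∀ᶠ x in nhds p, Disjoint (segment ℝ x q) K := by
  have hc : IsCompact (segment ℝ p q) := by
    rw [← convexHull_pair]
    exact (Set.toFinite ({p, q} : Set Pt)).isCompact_convexHull ℝ
  obtain ⟨ε, hε, hd⟩ := h.exists_thickenings hc hK
  filter_upwards [Metric.ball_mem_nhds p hε] with x hx
  rw [Set.disjoint_left]
  rintro y ⟨s, t, hs, ht, hst, rfl⟩ hy
  refine Set.disjoint_left.1 hd ?_ (Metric.self_subset_thickening hε _ hy)
  rw [Metric.mem_thickening_iff]
  refine ⟨s • p + t • q, ⟨s, t, hs, ht, hst, rfl⟩, ?_⟩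
  rw [dist_add_right, dist_eq_norm, ← smul_sub, norm_smul, Real.norm_of_nonneg hs, ← dist_eq_norm]
  have : dist x p < ε := hx
  have h0 : 0 ≤ dist x p := dist_nonneg
  nlinarith

/-! ### Frame at an extreme point -/

def uu (p : Pt) (β : ℝ) (q : Pt) : ℝ := (q.1 - p.1) + 2 * β * (q.2 - p.2)
def vv (p : Pt) (β : ℝ) (q : Pt) : ℝ := (q.1 - p.1) + β * (q.2 - p.2)
def ptOf (p : Pt) (β : ℝ) (a b : ℝ) : Pt := (p.1 + (2 * b - a), p.2 + (a - b) / β)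

lemma uu_self (p : Pt) (β : ℝ) : uu p β p = 0 := by simp [uu]
lemma vv_self (p : Pt) (β : ℝ) : vv p β p = 0 := by simp [vv]

lemma uu_ptOf (p : Pt) {β : ℝ} (hβ : 0 < β) (a b : ℝ) : uu p β (ptOf p β a b) = a := by
  simp only [uu, ptOf]; field_simp; ring

lemma vv_ptOf (p : Pt) {β : ℝ} (hβ : 0 < β) (a b : ℝ) : vv p β (ptOf p β a b) = b := by
  simp only [vv, ptOf]; field_simp; ring

lemma uu_cont (p : Pt) (β : ℝ) : Continuous (uu p β) := by unfold uu; fun_prop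
lemma vv_cont (p : Pt) (β : ℝ) : Continuous (vv p β) := by unfold vv; fun_prop

lemma aff_comb (p : Pt) (β k a b : ℝ) : IsAff (fun y => k + a * uu p β y + b * vv p β y) := by
  intro x y s t hst
  obtain rfl : s = 1 - t := by linarith
  simp only [uu, vv, Prod.fst_add, Prod.snd_add, Prod.smul_fst, Prod.smul_snd, smul_eq_mul]
  ring

/-- oriented area, in frame coordinates -/
def dd (p : Pt) (β : ℝ) (a b : Pt) : ℝ := uu p β a * vv p β b - vv p β a * uu p β b

lemma dd_swap (p : Pt) (β : ℝ) (a b : Pt) : dd p β a b = - dd p β b a := by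
  unfold dd; ring

lemma dd_self (p : Pt) (β : ℝ) (a : Pt) : dd p β a a = 0 := by unfold dd; ring
lemma dd_right (p : Pt) (β : ℝ) (a : Pt) : dd p β a p = 0 := by simp [dd, uu_self, vv_self]
lemma dd_left (p : Pt) (β : ℝ) (a : Pt) : dd p β p a = 0 := by simp [dd, uu_self, vv_self]

lemma dd_aff_right (p : Pt) (β : ℝ) (a : Pt) : IsAff (fun y => dd p β a y) := by
  have := aff_comb p β 0 (- vv p β a) (uu p β a)
  convert this using 2
  unfold dd; ring

lemma dd_aff_left (p : Pt) (β : ℝ) (a : Pt) : IsAff (fun y => dd p β y a) := by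
  have := aff_comb p β 0 (vv p β a) (- uu p β a)
  convert this using 2
  unfold dd; ring

lemma dd_cr (p : Pt) (β : ℝ) (a b : Pt) : dd p β a b = - β * cr p a b := by
  unfold dd cr uu vv; ring

def Frame (S : Finset Pt) (p : Pt) (β : ℝ) : Prop :=
  p ∈ S ∧ 0 < β ∧ ∀ q ∈ S, q ≠ p → 0 < uu p β q ∧ 0 < vv p β q

lemma exists_frame {S : Finset Pt} (hS : S.Nonempty) : ∃ p β, Frame S p β := by
  obtain ⟨p, hp, hmin⟩ := S.exists_min_image (fun q => (toLex q : ℝ ×ₗ ℝ)) hS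
  have hlex : ∀ q ∈ S, q ≠ p → p.1 < q.1 ∨ (p.1 = q.1 ∧ p.2 < q.2) := by
    intro q hq hqp
    have h1 := hmin q hq
    rw [Prod.Lex.toLex_le_toLex] at h1
    rcases h1 with h1 | ⟨h1, h2⟩
    · exact Or.inl h1
    · refine Or.inr ⟨h1, lt_of_le_of_ne h2 ?_⟩
      intro h3
      exact hqp (Prod.ext h1.symm h3.symm)
  have ev : ∀ k : ℝ, 0 < k → ∀ᶠ t in nhdsWithin (0:ℝ) (Set.Ioi 0), ∀ q ∈ S, q ≠ p →
      0 < (q.1 - p.1) + k * t * (q.2 - p.2) := by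
    intro k hk
    rw [Filter.eventually_all_finset]
    intro q hq
    by_cases hqp : q = p
    · exact Filter.Eventually.of_forall fun t h => absurd hqp h
    rcases hlex q hq hqp with h | ⟨h1, h2⟩
    · have hc : Continuous (fun t : ℝ => (q.1 - p.1) + k * t * (q.2 - p.2)) := by fun_prop
      have h0 : (0:ℝ) < (fun t : ℝ => (q.1 - p.1) + k * t * (q.2 - p.2)) 0 := by
        simp; exact h
      have := hc.continuousAt.eventually (lt_mem_nhds h0)
      exact (this.filter_mono nhdsWithin_le_nhds).mono fun t ht _ => ht
    · filter_upwards [self_mem_nhdsWithin] with t ht _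
      have ht' : (0:ℝ) < t := ht
      have : 0 < k * t * (q.2 - p.2) := by
        have : 0 < q.2 - p.2 := by linarith
        positivity
      linarith
  have ev0 : ∀ᶠ t in nhdsWithin (0:ℝ) (Set.Ioi 0), (0:ℝ) < t := self_mem_nhdsWithin
  obtain ⟨t, h1, h2, h0⟩ := ((ev 1 one_pos).and ((ev 2 two_pos).and ev0)).exists
  refine ⟨p, t, hp, h0, fun q hq hqp => ⟨h2 q hq hqp, ?_⟩⟩
  have := h1 q hq hqp
  simpa [vv] using this

/-! ### Step 1: doubling the extreme point -/

lemma step_one {S : Finset Pt} (hS : GenPos S) {p : Pt} {β : ℝ} (hf : Frame S p β) :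
    ∃ x, x ∉ S ∧ GenPos (insert x S) ∧ 0 < uu p β x ∧ vv p β x < 0 ∧
      scCount S ≤ Nat.card {G : PlaneGraph (insert x S) // IsSpanningCycle G ∧ s(p, x) ∈ G.edges} := by
  obtain ⟨hp, hβ, hq⟩ := hf
  have hclosed : ∀ a b : Pt, IsClosed (segment ℝ a b) := by
    intro a b
    rw [← convexHull_pair]
    exact ((Set.toFinite ({a, b} : Set Pt)).isCompact_convexHull ℝ).isClosed
  have hev : ∀ᶠ x in nhds p, ∀ q ∈ S, ∀ a ∈ S, ∀ b ∈ S,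
      Disjoint (segment ℝ p q) (segment ℝ a b) → Disjoint (segment ℝ x q) (segment ℝ a b) := by
    simp only [Filter.eventually_all_finset]
    intro q _ a _ b _
    by_cases h : Disjoint (segment ℝ p q) (segment ℝ a b)
    · exact (close_seg (hclosed a b) p q h).mono fun x hx _ => hx
    · exact Filter.Eventually.of_forall fun x h' => absurd h' h
  obtain ⟨V, hV, hVo, hpV⟩ := eventually_nhds_iff.1 hev
  have hne : (V ∩ {x | 0 < uu p β x ∧ vv p β x < 0}).Nonempty := by
    have hc : Continuous (fun t : ℝ => ptOf p β t (-t)) := by unfold ptOf; fun_prop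
    have h0 : ptOf p β 0 (-0) = p := by simp [ptOf]
    have h1 : ∀ᶠ t in nhds (0:ℝ), ptOf p β t (-t) ∈ V := by
      apply hc.continuousAt.eventually
      show V ∈ nhds (ptOf p β 0 (-0))
      rw [h0]
      exact hVo.mem_nhds hpV
    have ev0 : ∀ᶠ t in nhdsWithin (0:ℝ) (Set.Ioi 0), (0:ℝ) < t := self_mem_nhdsWithin
    obtain ⟨t, ht, ht0⟩ := ((h1.filter_mono nhdsWithin_le_nhds).and ev0).exists
    refine ⟨_, ht, ?_⟩
    simp only [Set.mem_ofPred_eq, uu_ptOf p hβ, vv_ptOf p hβ]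
    exact ⟨ht0, by linarith⟩
  have hopen : IsOpen (V ∩ {x | 0 < uu p β x ∧ vv p β x < 0}) := by
    apply hVo.inter
    exact (isOpen_lt continuous_const (uu_cont p β)).inter (isOpen_lt (vv_cont p β) continuous_const)
  obtain ⟨x, ⟨hxV, hxu, hxv⟩, hxS, hgen⟩ := exists_generic hS hopen hne
  refine ⟨x, hxS, hgen, hxu, hxv, ?_⟩
  have hdis := hV x hxV
  have hcongr : scCount S = Nat.card {G : PlaneGraph S // IsSpanningCycle G ∧ True} := by
    unfold scCount
    simp only [and_true]
  rw [hcongr]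
  apply step hxS hgen
  intro G hG _
  have main : ∀ q ∈ S, ∀ r ∈ S, q ≠ p → r ≠ p → s(p, q) ∈ G.edges →
      (∀ e ∈ G.edges, p ∈ e → e = s(p, q) ∨ e = s(p, r)) → 0 < dd p β q r →
      NoCross G p q x := by
    intro q hqS r hrS hqp hrp hpq hall hdd e he hne y hye
    have hmem := G.endpoint_mem e he
    have hdiag := G.not_isDiag e he
    have hxp : x ≠ p := by rintro rfl; exact hxS hp
    have hxq : x ≠ q := by rintro rfl; exact hxS hqS
    by_cases hpe : p ∈ e
    · have her : e = s(p, r) := (hall e he hpe).resolve_left hne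
      have hxr : x ≠ r := by rintro rfl; exact hxS hrS
      subst her
      rw [seg2_mk] at hye
      constructor
      · intro hy
        refine ⟨seg_inter (hgen p (by simp [hp]) x (by simp) r (by simp [hrS]) hxp.symm hrp.symm hxr)
          hy hye, by simp⟩
      · intro hy
        exfalso
        have hF := dd_aff_left p β r
        have h1 : dd p β y r = 0 := hF.zero hye (dd_left p β r) (dd_self p β r)
        have hr := hq r hrS hrp
        have h2 : 0 < dd p β x r := by
          unfold dd
          have := mul_pos hxu hr.2
          have := mul_pos (neg_pos.2 hxv) hr.1
          linarith
        have h3 : 0 < dd p β y r := hF.pos hy hdd h2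
        linarith
    · constructor
      · intro hy
        exfalso
        induction e with | h a b =>
        rw [seg2_mk] at hye
        have : Disjoint (segment ℝ p p) (segment ℝ a b) := by
          rw [segment_same, Set.disjoint_singleton_left]
          intro hpin
          exact hpe (G.noncrossing _ he _ hpq hne p ⟨hpin, left_mem_segment ℝ p q⟩).1
        have := hdis p hp a (hmem a (by simp)) b (hmem b (by simp)) this
        rw [segment_symm] at hy
        exact Set.disjoint_left.1 this hy hye
      · intro hy
        by_cases hqe : q ∈ e
        · refine ⟨?_, hqe⟩
          obtain ⟨b, rfl⟩ := Sym2.mem_iff_exists.1 hqe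
          have hbS := hmem b (by simp)
          have hqb : q ≠ b := by simpa using hdiag
          have hxb : x ≠ b := by rintro rfl; exact hxS hbS
          exact seg_inter (hgen q (by simp [hqS]) x (by simp) b (by simp [hbS]) hxq.symm hqb hxb)
            hy hye
        · exfalso
          induction e with | h a b =>
          rw [seg2_mk] at hye
          have : Disjoint (segment ℝ p q) (segment ℝ a b) := by
            rw [Set.disjoint_left]
            intro z hz1 hz2
            have := G.noncrossing _ he _ hpq hne z ⟨hz2, hz1⟩
            obtain ⟨h1, h2⟩ := this
            rw [Sym2.mem_iff (a := z) (b := p)] at h2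
            rcases h2 with rfl | rfl
            · exact hpe h1
            · exact hqe h1
          have := hdis q hqS a (hmem a (by simp)) b (hmem b (by simp)) this
          rw [segment_symm] at hy
          exact Set.disjoint_left.1 this hy hye
  obtain ⟨q, hqS, r, hrS, hqr, hqp, hrp, hpq, hpr, hall⟩ := cycE_neighbors hp hG
  have hne0 : dd p β q r ≠ 0 := by
    rw [dd_cr]
    have := cr_ne (hS p hp q hqS r hrS hqp.symm hrp.symm hqr)
    exact mul_ne_zero (by linarith) this
  rcases lt_or_gt_of_ne hne0 with h | h
  · refine ⟨r, hpr, main r hrS q hqS hrp hqp hpr (fun e he hpe => (hall e he hpe).symm) ?_⟩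
    rw [dd_swap]; linarith
  · exact ⟨q, hpq, main q hqS r hrS hqp hrp hpq hall h⟩

/-! ### Step 2: enclosing in a triangle -/

lemma step_two {S : Finset Pt} (hS : GenPos S) {p : Pt} {β : ℝ} (hf : Frame S p β) :
    ∃ T : Finset Pt, GenPos T ∧ T.card = S.card + 3 ∧ hullVtxCount T = 3 ∧ scCount S ≤ scCount T := by
  obtain ⟨x, hxS, hgx, hxu, hxv, hc1⟩ := step_one hS hf
  obtain ⟨hp, hβ, hq⟩ := hf
  have hxp : x ≠ p := by rintro rfl; exact hxS hp
  -- the point `c`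
  obtain ⟨M, hM⟩ : ∃ M : ℝ, ∀ q ∈ insert x S, uu p β q < M := by
    obtain ⟨M, hM⟩ := ((insert x S).image (uu p β)).bddAbove
    refine ⟨M + 1, fun q hq => ?_⟩
    have := hM (Finset.mem_coe.2 (Finset.mem_image_of_mem (uu p β) hq))
    linarith
  have hM0 : 0 < M := by
    have := hM p (by simp [hp])
    rwa [uu_self] at this
  let Uc : Set Pt := {c | M < uu p β c} ∩ ({c | vv p β c < 0} ∩ {c | dd p β x c < 0})
  have hUo : IsOpen Uc := by
    refine (isOpen_lt continuous_const (uu_cont p β)).inter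
      ((isOpen_lt (vv_cont p β) continuous_const).inter (isOpen_lt ?_ continuous_const))
    have := uu_cont p β
    have := vv_cont p β
    unfold dd
    fun_prop
  have hUn : Uc.Nonempty := by
    let N : ℝ := (- vv p β x * (M + 1)) / uu p β x + 1
    have hN : 0 < N := by
      have : 0 < - vv p β x := by linarith
      positivity
    refine ⟨ptOf p β (M + 1) (-N), ?_⟩
    simp only [Uc, Set.mem_inter_iff, Set.mem_ofPred_eq, dd, uu_ptOf p hβ, vv_ptOf p hβ]
    refine ⟨by linarith, by linarith, ?_⟩
    have : uu p β x * N = - vv p β x * (M + 1) + uu p β x := by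
      simp only [N]; field_simp
    linarith
  obtain ⟨c, ⟨hcu, hcv, hcd⟩, hcS, hgc⟩ := exists_generic hgx hUo hUn
  simp only [Set.mem_ofPred_eq] at hcu hcv hcd
  have hcu0 : 0 < uu p β c := by linarith
  have hcp : c ≠ p := by rintro rfl; exact hcS (by simp [hp])
  -- positivity of `dd c`
  have hFc : ∀ q ∈ insert x S, q ≠ p → 0 < dd p β c q := by
    intro q hqm hqp
    rw [Finset.mem_insert] at hqm
    rcases hqm with rfl | hqm
    · rw [dd_swap]; linarith
    · have := hq q hqm hqp
      unfold dd
      have := mul_pos hcu0 this.2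
      have := mul_pos (neg_pos.2 hcv) (hq q hqm hqp).1
      linarith
  -- the point `b`
  let Ub : Set Pt := ({b | uu p β b < 0} ∩ {b | 0 < vv p β b}) ∩
    (({b | 0 < dd p β x b} ∩ {b | 0 < dd p β c b}) ∩
    ⋂ q ∈ insert x S, {b | dd p β q b + dd p β c q < dd p β c b})
  have hddc : ∀ a, Continuous (fun b => dd p β a b) := by
    intro a
    have := uu_cont p β
    have := vv_cont p β
    unfold dd
    fun_prop
  have hUbo : IsOpen Ub := by
    refine IsOpen.inter ((isOpen_lt (uu_cont p β) continuous_const).inter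
      (isOpen_lt continuous_const (vv_cont p β))) (IsOpen.inter
      ((isOpen_lt continuous_const (hddc x)).inter (isOpen_lt continuous_const (hddc c))) ?_)
    refine isOpen_biInter_finset fun q _ => isOpen_lt ?_ (hddc c)
    exact (hddc q).add continuous_const
  have hUbn : Ub.Nonempty := by
    have ev1 : ∀ᶠ t : ℝ in Filter.atTop, 0 < t := Filter.eventually_gt_atTop 0
    have lin : ∀ k m : ℝ, 0 < k → ∀ᶠ t : ℝ in Filter.atTop, m < k * t := by
      intro k m hk
      exact (Filter.tendsto_id.const_mul_atTop hk).eventually_gt_atTop m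
    have ev2 := lin (uu p β x) (- vv p β x) hxu
    have ev3 := lin (uu p β c) (- vv p β c) hcu0
    have ev4 : ∀ᶠ t : ℝ in Filter.atTop, ∀ q ∈ insert x S,
        vv p β q + dd p β c q - vv p β c < (uu p β c - uu p β q) * t := by
      rw [Filter.eventually_all_finset]
      intro q hqm
      apply lin
      have := hM q hqm
      linarith
    obtain ⟨t, h1, h2, h3, h4⟩ := (ev1.and (ev2.and (ev3.and ev4))).exists
    refine ⟨ptOf p β (-1) t, ?_⟩
    have e : ∀ a, dd p β a (ptOf p β (-1) t) = uu p β a * t + vv p β a := by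
      intro a
      simp only [dd, uu_ptOf p hβ, vv_ptOf p hβ]
      ring
    simp only [Ub, Set.mem_inter_iff, Set.mem_iInter, Set.mem_ofPred_eq, uu_ptOf p hβ, vv_ptOf p hβ, e]
    refine ⟨⟨by norm_num, h1⟩, ⟨by linarith, by linarith⟩, ?_⟩
    intro q hqm
    have := h4 q hqm
    linarith
  obtain ⟨b, ⟨⟨hbu, hbv⟩, ⟨hbx, hbc⟩, hbq⟩, hbS, hgb⟩ := exists_generic hgc hUbo hUbn
  simp only [Set.mem_iInter, Set.mem_ofPred_eq] at hbu hbv hbx hbc hbq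
  have hFb : ∀ q ∈ insert c (insert x S), q ≠ p → 0 < dd p β q b := by
    intro q hqm hqp
    rw [Finset.mem_insert, Finset.mem_insert] at hqm
    rcases hqm with rfl | rfl | hqm
    · exact hbc
    · exact hbx
    · have h1 := hq q hqm hqp
      unfold dd
      have := mul_pos h1.1 hbv
      have := mul_pos h1.2 (neg_pos.2 hbu)
      linarith
  -- functional vanishing on the line `b c`
  let K : Pt → ℝ := fun y => dd p β c b - dd p β y b - dd p β c y
  have hKaff : IsAff K := by
    have := aff_comb p β (dd p β c b) (-(vv p β b) + vv p β c) (uu p β b - uu p β c)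
    convert this using 2
    simp only [K, dd]; ring
  have hKc : K c = 0 := by simp only [K, dd_self]; ring
  have hKb : K b = 0 := by simp only [K, dd_self]; ring
  have hKpos : ∀ q ∈ insert c (insert x S), q ≠ c → 0 < K q := by
    intro q hqm hqc
    rw [Finset.mem_insert] at hqm
    have := hbq q (hqm.resolve_left hqc)
    simp only [K]; linarith
  have hc2 : Nat.card {G : PlaneGraph (insert x S) // IsSpanningCycle G ∧ s(p, x) ∈ G.edges} ≤
      Nat.card {G : PlaneGraph (insert c (insert x S)) // IsSpanningCycle G ∧ s(p, c) ∈ G.edges} := by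
    apply step hcS hgc
    intro G hG hpx
    refine ⟨x, hpx, ?_⟩
    intro e he hne y hye
    constructor
    · intro hy
      exact support_noncross (dd_aff_right p β c) (dd_right p β c) (dd_self p β c) hFc G he hy hye
    · intro hy
      have hH := dd_aff_right p β x
      have hHpos : ∀ q ∈ insert x S, q ≠ p → q ≠ x → 0 < dd p β x q := by
        intro q hqm hqp hqx
        have h1 := hq q ((Finset.mem_insert.1 hqm).resolve_left hqx) hqp
        unfold dd
        have := mul_pos hxu h1.2
        have := mul_pos (neg_pos.2 hxv) h1.1
        linarith
      have hmem := G.endpoint_mem e he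
      have hdiag := G.not_isDiag e he
      have hyneg : dd p β x y ≤ 0 := by
        have := hH.neg.nonneg hy (by simp [dd_self]) (by linarith)
        linarith
      have hyx : 0 ≤ dd p β x y → y = x := by
        intro h0
        apply hH.neg.eq_end hy (by simp [dd_self]) (by linarith)
        linarith
      -- case analysis on the ends of `e`
      have cases1 : ∀ a b₁ : Pt, a ∈ insert x S → b₁ ∈ insert x S → a ≠ b₁ → s(a, b₁) ≠ s(p, x) →
          y ∈ segment ℝ a b₁ → a = p ∨ a = x → y = x ∧ x ∈ s(a, b₁) := by
        intro a b₁ ha hb' hab hne' hyab hcase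
        rcases hcase with rfl | rfl
        · exfalso
          have hbx' : b₁ ≠ x := by rintro rfl; exact hne' rfl
          have := hHpos b₁ hb' hab.symm hbx'
          have hya := hH.eq_end hyab (dd_right a β x) this hyneg
          have : y = x := hyx (by rw [hya, dd_right])
          exact hxp (this.symm.trans hya)
        · have hbp : b₁ ≠ p := by rintro rfl; exact hne' Sym2.eq_swap
          have := hHpos b₁ hb' hbp hab.symm
          exact ⟨hH.eq_end hyab (dd_self p β a) this hyneg, by simp⟩
      induction e with | h a b₁ =>
      rw [seg2_mk] at hye
      have ha := hmem a (by simp)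
      have hb' := hmem b₁ (by simp)
      have hab : a ≠ b₁ := by simpa using hdiag
      by_cases h1 : a = p ∨ a = x
      · exact cases1 a b₁ ha hb' hab hne hye h1
      · by_cases h2 : b₁ = p ∨ b₁ = x
        · rw [segment_symm] at hye
          rw [Sym2.eq_swap] at hne ⊢
          exact cases1 b₁ a hb' ha hab.symm hne hye h2
        · push Not at h1 h2
          have := hH.pos hye (hHpos a ha h1.1 h1.2) (hHpos b₁ hb' h2.1 h2.2)
          linarith
  have hc3 : Nat.card {G : PlaneGraph (insert c (insert x S)) // IsSpanningCycle G ∧ s(p, c) ∈ G.edges} ≤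
      Nat.card {G : PlaneGraph (insert b (insert c (insert x S))) //
        IsSpanningCycle G ∧ s(p, b) ∈ G.edges} := by
    apply step hbS hgb
    intro G hG hpc
    refine ⟨c, hpc, ?_⟩
    intro e he hne y hye
    constructor
    · intro hy
      exact support_noncross (dd_aff_left p β b) (dd_left p β b) (dd_self p β b) hFb G he hy hye
    · intro hy
      exact support_noncross hKaff hKc hKb hKpos G he hy hye
  have hc4 : Nat.card {G : PlaneGraph (insert b (insert c (insert x S))) //
        IsSpanningCycle G ∧ s(p, b) ∈ G.edges} ≤ scCount (insert b (insert c (insert x S))) := by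
    unfold scCount
    apply Nat.card_le_card_of_injective (fun G => ⟨G.1, G.2.1⟩)
    intro G H h
    apply Subtype.ext
    simpa using h
  refine ⟨insert b (insert c (insert x S)), hgb, ?_, ?_, hc1.trans (hc2.trans (hc3.trans hc4))⟩
  · rw [Finset.card_insert_of_notMem hbS, Finset.card_insert_of_notMem hcS,
      Finset.card_insert_of_notMem hxS]
  · have hbp : b ≠ p := by rintro rfl; exact hbS (by simp [hp])
    have hbc' : b ≠ c := by rintro rfl; exact hbS (by simp)
    have hfil : (insert b (insert c (insert x S))).filter
        (fun q => q ∈ frontier (convexHull ℝ (↑(insert b (insert c (insert x S))) : Set Pt))) = {p, b, c} := by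
      set T := insert b (insert c (insert x S)) with hT
      have hpT : p ∈ T := by simp [hT, hp]
      have hbT : b ∈ T := by simp [hT]
      have hcT : c ∈ T := by simp [hT]
      have sub : ∀ q ∈ T, q ∈ convexHull ℝ (T : Set Pt) := fun q hq => subset_convexHull ℝ _ hq
      -- supporting functionals
      have supp1 : ∀ F : Pt → ℝ, IsAff F → (∀ q ∈ T, 0 ≤ F q) → (∃ z, 0 < F z) → ∀ q ∈ T, F q = 0 →
          q ∈ frontier (convexHull ℝ (T : Set Pt)) := by
        intro F hF hpos hex q hqT hq0
        obtain ⟨z, hz⟩ := hex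
        have hconv : convexHull ℝ (T : Set Pt) ⊆ {y | 0 ≤ F y} := by
          apply convexHull_min
          · intro y hy; exact hpos y hy
          · intro a ha b hb s t hs ht hst
            simp only [Set.mem_ofPred_eq] at ha hb ⊢
            rw [hF _ _ _ _ hst]
            positivity
        refine ⟨subset_closure (sub q hqT), ?_⟩
        intro hint
        have hcont : Continuous (fun t : ℝ => (1 + t) • q + (-t) • z) := by fun_prop
        have h1 : ∀ᶠ t in nhds (0:ℝ), (1 + t) • q + (-t) • z ∈ interior (convexHull ℝ (T : Set Pt)) := by
          apply hcont.continuousAt.eventually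
          apply isOpen_interior.mem_nhds
          simpa using hint
        have ev0 : ∀ᶠ t in nhdsWithin (0:ℝ) (Set.Ioi 0), (0:ℝ) < t := self_mem_nhdsWithin
        obtain ⟨t, ht, ht0⟩ := ((h1.filter_mono nhdsWithin_le_nhds).and ev0).exists
        have := hconv (interior_subset ht)
        simp only [Set.mem_ofPred_eq] at this
        rw [hF _ _ _ _ (by ring), hq0] at this
        have := mul_pos ht0 hz
        linarith
      have posc : ∀ q ∈ T, 0 ≤ dd p β c q := by
        intro q hqT
        rw [hT, Finset.mem_insert, Finset.mem_insert] at hqT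
        by_cases hqp : q = p
        · rw [hqp, dd_right]
        · rcases hqT with rfl | rfl | h
          · exact hbc.le
          · rw [dd_self]
          · exact (hFc q h hqp).le
      have posb : ∀ q ∈ T, 0 ≤ dd p β q b := by
        intro q hqT
        rw [hT, Finset.mem_insert] at hqT
        by_cases hqp : q = p
        · rw [hqp, dd_left]
        · rcases hqT with rfl | h
          · rw [dd_self]
          · exact (hFb q h hqp).le
      ext q
      simp only [Finset.mem_filter, Finset.mem_insert, Finset.mem_singleton]
      constructor
      · rintro ⟨hqT, hfr⟩
        by_contra hcon
        push Not at hcon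
        obtain ⟨hqp, hqb, hqc⟩ := hcon
        have hq2 : q ∈ insert c (insert x S) := (Finset.mem_insert.1 hqT).resolve_left hqb
        have hq1 : q ∈ insert x S := (Finset.mem_insert.1 hq2).resolve_left hqc
        apply hfr.2
        rw [mem_interior]
        refine ⟨{y | (0 < dd p β y b ∧ 0 < dd p β c y) ∧ 0 < K y}, ?_, ?_, ⟨hFb q hq2 hqp, hFc q hq1 hqp⟩,
          hKpos q hq2 hqc⟩
        · rintro y ⟨⟨h1, h2⟩, h3⟩
          have hy : y = (K y / dd p β c b) • p + (dd p β y b / dd p β c b) • c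
              + (dd p β c y / dd p β c b) • b := by
            have hW := hbc.ne'
            have hβ' := hβ.ne'
            have id1 : uu p β y * dd p β c b = dd p β y b * uu p β c + dd p β c y * uu p β b := by
              unfold dd; ring
            have id2 : vv p β y * dd p β c b = dd p β y b * vv p β c + dd p β c y * vv p β b := by
              unfold dd; ring
            simp only [K]
            generalize dd p β c b = w at *
            generalize dd p β y b = w1 at *
            generalize dd p β c y = w2 at *
            unfold uu at id1
            unfold vv at id2
            have id3 : (y.2 - p.2) * w = w1 * (c.2 - p.2) + w2 * (b.2 - p.2) := by
              apply mul_left_cancel₀ hβ'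
              linear_combination id1 - id2
            have id4 : (y.1 - p.1) * w = w1 * (c.1 - p.1) + w2 * (b.1 - p.1) := by
              linear_combination 2 * id2 - id1
            ext
            · simp
              field_simp
              linear_combination id4
            · simp
              field_simp
              linear_combination id3
          have hconv := convex_convexHull ℝ (T : Set Pt)
          rw [hy]
          have hsum : K y / dd p β c b + dd p β y b / dd p β c b + dd p β c y / dd p β c b = 1 := by
            have hW := hbc.ne'
            simp only [K]
            field_simp
            ring
          have := hconv.sum_mem (t := Finset.univ)
            (w := ![K y / dd p β c b, dd p β y b / dd p β c b, dd p β c y / dd p β c b])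
            (z := ![p, c, b]) (by
              intro i _
              fin_cases i <;> simp <;> positivity) (by
              simp [Fin.sum_univ_three, hsum]) (by
              intro i _
              fin_cases i
              · exact sub p hpT
              · exact sub c hcT
              · exact sub b hbT)
          simpa [Fin.sum_univ_three] using this
        · have hcl : Continuous (fun y => dd p β y b) := by
            have := uu_cont p β
            have := vv_cont p β
            unfold dd
            fun_prop
          exact ((isOpen_lt continuous_const hcl).inter (isOpen_lt continuous_const (hddc c))).inter
            (isOpen_lt continuous_const ((continuous_const.sub hcl).sub (hddc c)))
      · rintro (rfl | rfl | rfl)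
        · exact ⟨hpT, supp1 _ (dd_aff_right q β c) posc ⟨b, hbc⟩ q hpT (dd_right q β c)⟩
        · exact ⟨hbT, supp1 _ (dd_aff_left p β q) posb ⟨c, hbc⟩ q hbT (dd_self p β q)⟩
        · exact ⟨hcT, supp1 _ (dd_aff_right p β q) posc ⟨b, hbc⟩ q hcT (dd_self p β q)⟩
    unfold hullVtxCount
    rw [hfil]
    rw [Finset.card_insert_of_notMem, Finset.card_insert_of_notMem, Finset.card_singleton]
    · simpa using hbc'
    · simp only [Finset.mem_insert, Finset.mem_singleton, not_or]
      exact ⟨hbp.symm, hcp.symm⟩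

lemma add_point {S : Finset Pt} (hS : GenPos S) (hne : S.Nonempty) :
    ∃ T : Finset Pt, GenPos T ∧ T.card = S.card + 1 ∧ T.Nonempty ∧ scCount S ≤ scCount T := by
  obtain ⟨p, β, hf⟩ := exists_frame hne
  obtain ⟨x, hxS, hgx, -, -, hc1⟩ := step_one hS hf
  refine ⟨insert x S, hgx, Finset.card_insert_of_notMem hxS, by simp, hc1.trans ?_⟩
  unfold scCount
  apply Nat.card_le_card_of_injective (fun G => ⟨G.1, G.2.1⟩)
  intro G H h
  apply Subtype.ext
  simpa using h

/-- If `sc(S) ≤ A · c^{|S|}` for all even-size point sets in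
general position with a triangular convex hull, then an analogous bound holds
for all finite point sets in general position. -/
theorem statement12 (c A : ℝ) (hc : 1 < c) (hA : 0 < A)
    (h : ∀ S : Finset Pt, GenPos S → Even S.card → hullVtxCount S = 3 →
      (scCount S : ℝ) ≤ A * c ^ S.card) :
    ∃ A' : ℝ, 0 < A' ∧ ∀ S : Finset Pt, GenPos S →
      (scCount S : ℝ) ≤ A' * c ^ S.card := by
  refine ⟨A * c ^ 4, by positivity, ?_⟩
  intro S hS
  have hc0 : 0 < c := by linarith
  rcases S.eq_empty_or_nonempty with rfl | hne
  · have : scCount ∅ = 0 := by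
      unfold scCount
      have : IsEmpty {G : PlaneGraph ∅ // IsSpanningCycle G} := by
        refine ⟨fun G => ?_⟩
        have := G.2.1
        simp at this
      simp
    rw [this]
    push_cast
    positivity
  have odd_case : ∀ S : Finset Pt, GenPos S → S.Nonempty → ¬ Even S.card →
      (scCount S : ℝ) ≤ A * c ^ (S.card + 3) := by
    intro S hS hne hodd
    obtain ⟨p, β, hf⟩ := exists_frame hne
    obtain ⟨T, hT, hcard, hhull, hle⟩ := step_two hS hf
    have hev : Even T.card := by
      rw [hcard]
      rw [Nat.not_even_iff_odd] at hodd
      exact hodd.add_odd (by decide)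
    have := h T hT hev hhull
    rw [hcard] at this
    exact le_trans (by exact_mod_cast hle) this
  by_cases hev : Even S.card
  · obtain ⟨T, hT, hcard, hTne, hle⟩ := add_point hS hne
    have := odd_case T hT hTne (by rw [hcard, Nat.even_add_one]; simpa using hev)
    rw [hcard] at this
    calc (scCount S : ℝ) ≤ scCount T := by exact_mod_cast hle
      _ ≤ _ := this
      _ = A * c ^ 4 * c ^ S.card := by ring
  · calc (scCount S : ℝ) ≤ A * c ^ (S.card + 3) := odd_case S hS hne hev
      _ ≤ A * c ^ (S.card + 4) := by
        have : c ^ (S.card + 3) ≤ c ^ (S.card + 4) := pow_le_pow_right₀ hc.le (by omega)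
        exact mul_le_mul_of_nonneg_left this hA.le
      _ = A * c ^ 4 * c ^ S.card := by ring

end
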